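/- Let R be a commutative ring, s ∈ R, n ≥ 1, and let F_1,…,F_n and G_1,…,G_n be R-modules with R-linear maps f_i, f'_i, g_i, g'_i (1 ≤ i ≤ n−1) satisfying f_i ∘ f'_i = f'_i ∘ f_i = s·id and g_i ∘ g'_i = g'_i ∘ g_i = s·id. Suppose each G_i has an internal direct sum decomposition G_i = G'_i ⊕ G''_i such that g_i(G'_i) ⊆ G'_{i+1}, g_i(G''_i) ⊆ G''_{i+1}, g'_i(G'_{i+1}) ⊆ G'_i, g'_i(G''_{i+1}) ⊆ G''_i, and the induced maps (g_i)' : G'_i → G'_{i+1} and (g'_i)'' : G''_{i+1} → G''_i are isomorphisms. Given R-linear maps ψ : F_1 → G''_1 and χ : F_n → G'_n, define for each 1 ≤ i ≤ n the map φ_i : F_i → G_i as the sum of ((g_{i,n})')⁻¹ ∘ χ ∘ f_{i,n} (landing in G'_i) and ((g'^{i,1})'')⁻¹ ∘ ψ ∘ f'^{i,1} (landing in G''_i), where f_{i,n} = f_{n−1} ∘ ⋯ ∘ f_i, f'^{i,1} = f'_1 ∘ ⋯ ∘ f'_{i−1}, (g_{i,n})' = (g_{n−1})' ∘ ⋯ ∘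 (g_i)', (g'^{i,1})'' = (g'_1)'' ∘ ⋯ ∘ (g'_{i−1})'', with empty composites equal to the identity. Then (φ_1,…,φ_n) is a linked tuple: φ_{i+1} ∘ f_i = g_i ∘ φ_i and φ_i ∘ f'_i = g'_i ∘ φ_{i+1} for all 1 ≤ i ≤ n−1. -/

import Mathlib

/-!
Statement 9 (existence part of the main theorem of Osserman, "Linked Hom
spaces"): the tuple `(φ_1, …, φ_n)` defined from `ψ : F_1 → G''_1` and
`χ : F_n → G'_n` by
`φ_i = ((g_{i,n})')⁻¹ ∘ χ ∘ f_{i,n} + ((g'^{i,1})'')⁻¹ ∘ ψ ∘ f'^{i,1}`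
is a linked tuple.  The chains `F_1, …, F_n` and `G_1, …, G_n` of the paper
are indexed here by `0, …, n-1`.  The isomorphisms induced by the `g`- and
`g'`-maps on the pieces of the decompositions are given as linear
equivalences `e i`, `e'' i` compatible with `g i`, `g' i`.
-/

open LinearMap Module

/-- The composite `f_{j-1} ∘ ⋯ ∘ f_i : F i →ₗ F j` (the identity for `i = j`);
this is the map denoted `f_{i,j}` in the paper. -/
def fComp {R : Type*} [Semiring R] {F : ℕ → Type*}
    [∀ i, AddCommMonoid (F i)] [∀ i, Module R (F i)]
    (f : ∀ i, F i →ₗ[R] F (i + 1)) : ∀ {i j : ℕ}, i ≤ j → (F i →ₗ[R] F j) :=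
  fun {i j} h =>
    Nat.leRec (motive := fun m _ => F i →ₗ[R] F m) LinearMap.id
      (fun m _ acc => (f m).comp acc) h

/-- The composite `f'_i ∘ ⋯ ∘ f'_{j-1} : F j →ₗ F i` (the identity for `i = j`);
this is the map denoted `f^{j,i}` in the paper. -/
def f'Comp {R : Type*} [Semiring R] {F : ℕ → Type*}
    [∀ i, AddCommMonoid (F i)] [∀ i, Module R (F i)]
    (f' : ∀ i, F (i + 1) →ₗ[R] F i) : ∀ {i j : ℕ}, i ≤ j → (F j →ₗ[R] F i) :=
  fun {i j} h =>
    Nat.leRec (motive := fun m _ => F m →ₗ[R] F i) LinearMap.id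
      (fun m _ acc => acc.comp (f' m)) h

/-- The composite `(g_{j-1})' ∘ ⋯ ∘ (g_i)' : G'_i ≃ₗ G'_j` of the induced
isomorphisms `e m : G'_m ≃ₗ G'_{m+1}`; the map `(g_{i,j})'` of the paper. -/
def eComp {R : Type*} [CommRing R] {n : ℕ} {G : ℕ → Type*}
    [∀ i, AddCommGroup (G i)] [∀ i, Module R (G i)] {G₁ : ∀ i, Submodule R (G i)}
    (e : ∀ i, i + 2 ≤ n → (G₁ i ≃ₗ[R] G₁ (i + 1))) :
    ∀ {i j : ℕ}, i ≤ j → j + 1 ≤ n → (G₁ i ≃ₗ[R] G₁ j) :=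
  fun {i j} hij =>
    Nat.leRec (motive := fun m _ => m + 1 ≤ n → (↥(G₁ i) ≃ₗ[R] ↥(G₁ m)))
      (fun _ => LinearEquiv.refl R _)
      (fun m _ acc hm1 => (acc (by omega)).trans (e m (by omega))) hij

/-- The composite `(g'_i)'' ∘ ⋯ ∘ (g'_{j-1})'' : G''_j ≃ₗ G''_i` of the induced
isomorphisms `e'' m : G''_{m+1} ≃ₗ G''_m`; the map `(g'^{j,i})''` of the paper. -/
def e''Comp {R : Type*} [CommRing R] {n : ℕ} {G : ℕ → Type*}
    [∀ i, AddCommGroup (G i)] [∀ i, Module R (G i)] {G₂ : ∀ i, Submodule R (G i)}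
    (e'' : ∀ i, i + 2 ≤ n → (G₂ (i + 1) ≃ₗ[R] G₂ i)) :
    ∀ {i j : ℕ}, i ≤ j → j + 1 ≤ n → (G₂ j ≃ₗ[R] G₂ i) :=
  fun {i j} hij =>
    Nat.leRec (motive := fun m _ => m + 1 ≤ n → (↥(G₂ m) ≃ₗ[R] ↥(G₂ i)))
      (fun _ => LinearEquiv.refl R _)
      (fun m _ acc hm1 => (e'' m (by omega)).trans (acc (by omega))) hij

theorem fComp_succ_right {R : Type*} [Semiring R] {F : ℕ → Type*}
    [∀ i, AddCommMonoid (F i)] [∀ i, Module R (F i)]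
    (f : ∀ i, F i →ₗ[R] F (i + 1)) {i j : ℕ} (h : i ≤ j) (h' : i ≤ j + 1) :
    fComp f h' = f j ∘ₗ fComp f h :=
  Nat.leRec_succ _ _ h

theorem fComp_eq_comp_left {R : Type*} [Semiring R] {F : ℕ → Type*}
    [∀ i, AddCommMonoid (F i)] [∀ i, Module R (F i)]
    (f : ∀ i, F i →ₗ[R] F (i + 1)) {i j : ℕ} (h : i + 1 ≤ j) (h' : i ≤ j) :
    fComp f h' = fComp f h ∘ₗ f i := by
  induction j, h using Nat.le_induction with
  | base =>
    rw [fComp_succ_right f le_rfl]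
    simp [fComp, Nat.leRec_self]
  | succ m hm ih =>
    rw [fComp_succ_right f (by omega : i ≤ m), fComp_succ_right f hm, ih, LinearMap.comp_assoc]

theorem f'Comp_succ_right {R : Type*} [Semiring R] {F : ℕ → Type*}
    [∀ i, AddCommMonoid (F i)] [∀ i, Module R (F i)]
    (f' : ∀ i, F (i + 1) →ₗ[R] F i) {i j : ℕ} (h : i ≤ j) (h' : i ≤ j + 1) :
    f'Comp f' h' = f'Comp f' h ∘ₗ f' j :=
  Nat.leRec_succ _ _ h

theorem eComp_succ_right {R : Type*} [CommRing R] {n : ℕ} {G : ℕ → Type*}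
    [∀ i, AddCommGroup (G i)] [∀ i, Module R (G i)] {G₁ : ∀ i, Submodule R (G i)}
    (e : ∀ i, i + 2 ≤ n → (G₁ i ≃ₗ[R] G₁ (i + 1))) {i j : ℕ} (h : i ≤ j) (h' : i ≤ j + 1)
    (hj : j + 1 + 1 ≤ n) :
    eComp e h' hj = (eComp e h (by omega)).trans (e j hj) :=
  congrFun (Nat.leRec_succ (motive := fun m _ => m + 1 ≤ n → (↥(G₁ i) ≃ₗ[R] ↥(G₁ m))) _ _ h) hj

theorem eComp_eq_trans_left {R : Type*} [CommRing R] {n : ℕ} {G : ℕ → Type*}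
    [∀ i, AddCommGroup (G i)] [∀ i, Module R (G i)] {G₁ : ∀ i, Submodule R (G i)}
    (e : ∀ i, i + 2 ≤ n → (G₁ i ≃ₗ[R] G₁ (i + 1))) {i j : ℕ} (h : i + 1 ≤ j) (h' : i ≤ j)
    (hj : j + 1 ≤ n) :
    eComp e h' hj = (e i (by omega)).trans (eComp e h hj) := by
  induction j, h using Nat.le_induction with
  | base =>
    rw [eComp_succ_right e le_rfl]
    ext
    simp [eComp, Nat.leRec_self]
  | succ m hm ih =>
    rw [eComp_succ_right e (by omega : i ≤ m), eComp_succ_right e hm, ih, LinearEquiv.trans_assoc]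

theorem e''Comp_succ_right {R : Type*} [CommRing R] {n : ℕ} {G : ℕ → Type*}
    [∀ i, AddCommGroup (G i)] [∀ i, Module R (G i)] {G₂ : ∀ i, Submodule R (G i)}
    (e'' : ∀ i, i + 2 ≤ n → (G₂ (i + 1) ≃ₗ[R] G₂ i)) {i j : ℕ} (h : i ≤ j) (h' : i ≤ j + 1)
    (hj : j + 1 + 1 ≤ n) :
    e''Comp e'' h' hj = (e'' j hj).trans (e''Comp e'' h (by omega)) :=
  congrFun (Nat.leRec_succ (motive := fun m _ => m + 1 ≤ n → (↥(G₂ m) ≃ₗ[R] ↥(G₂ i))) _ _ h) hj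

theorem linked_of_formula (R : Type*) [CommRing R] (s : R) (n : ℕ) (hn : 1 ≤ n)
    (F G : ℕ → Type*)
    [∀ i, AddCommGroup (F i)] [∀ i, Module R (F i)]
    [∀ i, AddCommGroup (G i)] [∀ i, Module R (G i)]
    (f : ∀ i, F i →ₗ[R] F (i + 1)) (f' : ∀ i, F (i + 1) →ₗ[R] F i)
    (g : ∀ i, G i →ₗ[R] G (i + 1)) (g' : ∀ i, G (i + 1) →ₗ[R] G i)
    (hf : ∀ i, i + 2 ≤ n → (f i).comp (f' i) = s • LinearMap.id ∧
      (f' i).comp (f i) = s • LinearMap.id)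
    (hg : ∀ i, i + 2 ≤ n → (g i).comp (g' i) = s • LinearMap.id ∧
      (g' i).comp (g i) = s • LinearMap.id)
    -- the internal direct sum decompositions `G_i = G'_i ⊕ G''_i`:
    (G₁ G₂ : ∀ i, Submodule R (G i))
    (hcompl : ∀ i, i < n → IsCompl (G₁ i) (G₂ i))
    -- the `g`-maps preserve the decompositions:
    (hgG₁ : ∀ i (_ : i + 2 ≤ n), ∀ x ∈ G₁ i, g i x ∈ G₁ (i + 1))
    (hgG₂ : ∀ i (_ : i + 2 ≤ n), ∀ x ∈ G₂ i, g i x ∈ G₂ (i + 1))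
    (hg'G₁ : ∀ i (_ : i + 2 ≤ n), ∀ x ∈ G₁ (i + 1), g' i x ∈ G₁ i)
    (hg'G₂ : ∀ i (_ : i + 2 ≤ n), ∀ x ∈ G₂ (i + 1), g' i x ∈ G₂ i)
    -- the induced maps `(g_i)' : G'_i → G'_{i+1}` and `(g'_i)'' : G''_{i+1} → G''_i`
    -- are isomorphisms, given as the linear equivalences `e i`, `e'' i`:
    (e : ∀ i, i + 2 ≤ n → (G₁ i ≃ₗ[R] G₁ (i + 1)))
    (he : ∀ i (h : i + 2 ≤ n) (x : G₁ i), (e i h x : G (i + 1)) = g i x)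
    (e'' : ∀ i, i + 2 ≤ n → (G₂ (i + 1) ≃ₗ[R] G₂ i))
    (he'' : ∀ i (h : i + 2 ≤ n) (x : G₂ (i + 1)), (e'' i h x : G i) = g' i x)
    -- the data `ψ : F_1 → G''_1` and `χ : F_n → G'_n`:
    (ψ : F 0 →ₗ[R] G₂ 0) (χ : F (n - 1) →ₗ[R] G₁ (n - 1))
    -- `(φ_1, …, φ_n)` is defined by the formula
    -- `φ_i = ((g_{i,n})')⁻¹ ∘ χ ∘ f_{i,n} + ((g'^{i,1})'')⁻¹ ∘ ψ ∘ f'^{i,1}`: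
    (φ : ∀ i, F i →ₗ[R] G i)
    (hφ : ∀ i (hi : i + 1 ≤ n),
      φ i =
        (G₁ i).subtype ∘ₗ
            (eComp e (show i ≤ n - 1 by omega) (show n - 1 + 1 ≤ n by omega)).symm.toLinearMap ∘ₗ
            χ ∘ₗ fComp f (show i ≤ n - 1 by omega) +
          (G₂ i).subtype ∘ₗ (e''Comp e'' (Nat.zero_le i) hi).symm.toLinearMap ∘ₗ
            ψ ∘ₗ f'Comp f' (Nat.zero_le i)) :
    -- then `(φ_1, …, φ_n)` is a linked tuple:
    ∀ i, i + 2 ≤ n →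
      (φ (i + 1)).comp (f i) = (g i).comp (φ i) ∧
      (φ i).comp (f' i) = (g' i).comp (φ (i + 1)) := by
  intro i hi
  have hff (x) : f i (f' i x) = s • x := LinearMap.congr_fun (hf i hi).1 x
  have hff' (x) : f' i (f i x) = s • x := LinearMap.congr_fun (hf i hi).2 x
  have hgg (x) : g i (g' i x) = s • x := LinearMap.congr_fun (hg i hi).1 x
  have hgg' (x) : g' i (g i x) = s • x := LinearMap.congr_fun (hg i hi).2 x
  have hge (y : G₁ (i + 1)) : g i ((e i hi).symm y) = y := by
    rw [← he i hi, LinearEquiv.apply_symm_apply]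
  have hge' (y : G₂ i) : g' i ((e'' i hi).symm y) = y := by
    rw [← he'' i hi, LinearEquiv.apply_symm_apply]
  have hgs (y : G₂ i) : g i y = s • ((e'' i hi).symm y : G (i + 1)) := by
    rw [← hgg, hge']
  have hgs' (y : G₁ (i + 1)) : g' i y = s • ((e i hi).symm y : G i) := by
    rw [← hgg', hge]
  rw [hφ i (by omega), hφ (i + 1) hi,
    fComp_eq_comp_left f (by omega : i + 1 ≤ n - 1),
    eComp_eq_trans_left e (by omega : i + 1 ≤ n - 1),
    f'Comp_succ_right f' (Nat.zero_le i), e''Comp_succ_right e'' (Nat.zero_le i)]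
  constructor <;> ext x
  · simp [hff', hge, hgs]
  · simp [hff, hge', hgs']
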